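/- arXiv:2011.08220 — 4 statements merged into one kernel-verified Lean document; each statement's English description precedes it below -/
import Mathlib

section
/- Let n ≥ 0, r ≥ 2 and 1 ≤ t ≤ r−1 be integers. Then |O_{1,r}(n)| = |D_{1,r}(n)| = E_{r,t}(n), i.e., the number of partitions of n with exactly one part size divisible by r equals the number of partitions of n in which exactly one part size appears at least r times, and both equal the excess of the number of parts congruent to t mod r in all r-regular partitions of n over the number of different part sizes appearing at least t times in all partitions of n with no part repeated more than r−1 times. -/
open scoped Classical

namespace BeckPaper

/-- The parts of a partition, sorted in non-increasing order. -/
def partsList {n : ℕ} (p : n.Partition) : List ℕ := p.parts.sort (· ≥ ·)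

/-- The `i`-th part of a partition (`1`-indexed); `0` if `i` exceeds the number of parts. -/
def part {n : ℕ} (p : n.Partition) (i : ℕ) : ℕ := (partsList p).getD (i - 1) 0

/-- `ℓ(λ)`: the number of parts of `λ`. -/
def numParts {n : ℕ} (p : n.Partition) : ℕ := Multiset.card p.parts

/-- `ℓ_t(λ)`: the number of parts of `λ` congruent to `t` modulo `r`. -/
def lMod (r t : ℕ) {n : ℕ} (p : n.Partition) : ℕ :=
  Multiset.card (p.parts.filter (fun x => x % r = t % r))

/-- `ℓ̄_t(λ)`: the number of different part sizes appearing at least `t` times in `λ`. -/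
def lRep (t : ℕ) {n : ℕ} (p : n.Partition) : ℕ :=
  (p.parts.toFinset.filter (fun s => t ≤ p.parts.count s)).card

/-- `ℓ̄(λ)`: the number of different part sizes of `λ`. -/
def lDist {n : ℕ} (p : n.Partition) : ℕ := p.parts.toFinset.card

/-- `d_t(λ)`: the number of indices `1 ≤ i ≤ ℓ(λ)` with `λ_i − λ_{i+1} ≥ t`. -/
def dCount (t : ℕ) {n : ℕ} (p : n.Partition) : ℕ :=
  ((Finset.Icc 1 (numParts p)).filter (fun i => t ≤ part p i - part p (i + 1))).card

/-- `λ ∈ O_r(n)`: no part is divisible by `r`. -/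
def IsRegular (r : ℕ) {n : ℕ} (p : n.Partition) : Prop := ∀ x ∈ p.parts, ¬ r ∣ x

/-- `λ ∈ D_r(n)`: no part appears more than `r − 1` times. -/
def IsRestricted (r : ℕ) {n : ℕ} (p : n.Partition) : Prop :=
  ∀ s : ℕ, p.parts.count s ≤ r - 1

/-- `λ ∈ F_r(n)`: all differences of consecutive parts (with `λ_{k+1} = 0`) are `≤ r − 1`. -/
def IsFlat (r : ℕ) {n : ℕ} (p : n.Partition) : Prop :=
  ∀ i, 1 ≤ i → i ≤ numParts p → part p i - part p (i + 1) ≤ r - 1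

/-- `λ ∈ O_{1,r}(n)`: the set of part sizes divisible by `r` has exactly one element. -/
def IsOneRegular (r : ℕ) {n : ℕ} (p : n.Partition) : Prop :=
  (p.parts.toFinset.filter (fun s => r ∣ s)).card = 1

/-- `λ ∈ D_{1,r}(n)`: exactly one part size appears at least `r` times. -/
def IsOneRestricted (r : ℕ) {n : ℕ} (p : n.Partition) : Prop :=
  (p.parts.toFinset.filter (fun s => r ≤ p.parts.count s)).card = 1

/-- `λ ∈ F_{1,r}(n)`: exactly one difference of consecutive parts is `≥ r`, and all
other such differences are `≤ r − 1`. -/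
def IsOneFlat (r : ℕ) {n : ℕ} (p : n.Partition) : Prop :=
  ∃ i, (1 ≤ i ∧ i ≤ numParts p ∧ r ≤ part p i - part p (i + 1)) ∧
    ∀ j, 1 ≤ j → j ≤ numParts p → j ≠ i → part p j - part p (j + 1) ≤ r - 1

/-- `λ ∈ T_r(n)`: exactly one part size has multiplicity at least `r`, and that
multiplicity is strictly less than `2r`. -/
def IsInT (r : ℕ) {n : ℕ} (p : n.Partition) : Prop :=
  ∃ s : ℕ, (r ≤ p.parts.count s ∧ p.parts.count s < 2 * r) ∧
    ∀ s' : ℕ, r ≤ p.parts.count s' → s' = s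

noncomputable def C (n : ℕ) (P : Multiset ℕ → Prop) : ℕ :=
  (Finset.univ.filter (fun p : n.Partition => P p.parts)).card

def Restr (r : ℕ) (M : Multiset ℕ) : Prop := ∀ s : ℕ, M.count s ≤ r - 1
def Reg (r : ℕ) (M : Multiset ℕ) : Prop := ∀ x ∈ M, ¬ r ∣ x

lemma C_congr (n : ℕ) (P Q : Multiset ℕ → Prop)
    (h : ∀ p : n.Partition, P p.parts ↔ Q p.parts) : C n P = C n Q := by
  unfold C
  congr 1
  ext p
  simp [h]

lemma C_shift (n s c : ℕ) (hs : 1 ≤ s) (P : Multiset ℕ → Prop) :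
    C n (fun M => P M ∧ c ≤ M.count s) =
      if s * c ≤ n then C (n - s * c) (fun M => P (M + Multiset.replicate c s)) else 0 := by
  have key : ∀ p : n.Partition, c ≤ p.parts.count s →
      (p.parts - Multiset.replicate c s) + Multiset.replicate c s = p.parts := fun p h =>
    tsub_add_cancel_of_le (Multiset.le_count_iff_replicate_le.1 h)
  have keys : ∀ p : n.Partition, c ≤ p.parts.count s →
      (p.parts - Multiset.replicate c s).sum + s * c = n := fun p h => by
    have := congrArg Multiset.sum (key p h)
    rw [p.parts_sum] at this
    simpa [mul_comm] using this
  split_ifs with h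
  · unfold C
    symm
    refine Finset.card_bij (fun q _ => (⟨q.parts + Multiset.replicate c s, ?_, ?_⟩ : n.Partition))
      ?_ ?_ ?_
    · intro i hi
      rcases Multiset.mem_add.1 hi with hi | hi
      · exact q.parts_pos hi
      · rw [Multiset.eq_of_mem_replicate hi]; exact hs
    · have := q.parts_sum
      simp only [Multiset.sum_add, Multiset.sum_replicate, this, smul_eq_mul, mul_comm c s]
      omega
    · intro q hq
      simpa using hq
    · intro a _ b _ hab
      simp only [Nat.Partition.mk.injEq, add_left_inj] at hab
      exact Nat.Partition.ext hab
    · intro p hp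
      simp only [Finset.mem_filter, Finset.mem_univ, true_and] at hp
      refine ⟨⟨p.parts - Multiset.replicate c s, fun hi => p.parts_pos
        (Multiset.mem_of_le tsub_le_self hi), ?_⟩, ?_, ?_⟩
      · have := keys p hp.2
        omega
      · simp [key p hp.2, hp.1]
      · ext1
        simp [key p hp.2]
  · unfold C
    refine Finset.card_eq_zero.2 (Finset.eq_empty_of_forall_notMem fun p hp => ?_)
    simp only [Finset.mem_filter] at hp
    have := keys p hp.2.2
    omega

/-- shifted count -/
noncomputable def e' (r n k : ℕ) : ℕ := if k ≤ n then C (n - k) (Restr r) else 0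

lemma C_reg_eq (r n : ℕ) (hr : 2 ≤ r) : C n (Reg r) = C n (Restr r) := by
  have h := Nat.Partition.card_restricted_eq_card_countRestricted n (m := r) (by omega)
  unfold Nat.Partition.restricted Nat.Partition.countRestricted at h
  unfold C Reg Restr
  have e1 : Finset.univ.filter (fun p : n.Partition => ∀ s : ℕ, p.parts.count s ≤ r - 1) =
      Finset.univ.filter (fun p : n.Partition => ∀ i ∈ p.parts, p.parts.count i < r) := by
    ext p
    simp only [Finset.mem_filter, Finset.mem_univ, true_and]
    constructor
    · intro h x hx
      have := h x
      omega
    · intro h x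
      by_cases hx : x ∈ p.parts
      · have := h x hx
        omega
      · simp [Multiset.count_eq_zero_of_notMem hx]
  rw [e1]
  convert h using 2
  ext p
  simp only [Finset.mem_filter]

lemma C_reg_shift (r n s c : ℕ) (hr : 2 ≤ r) (hs : 1 ≤ s) (hd : ¬ r ∣ s) :
    C n (fun M => Reg r M ∧ c ≤ M.count s) = e' r n (s * c) := by
  rw [C_shift n s c hs, e']
  split_ifs with h
  · rw [← C_reg_eq _ _ hr]
    apply C_congr
    intro p
    unfold Reg
    constructor
    · intro h x hx
      exact h x (by simp [hx])
    · intro h x hx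
      rcases Multiset.mem_add.1 hx with hx | hx
      · exact h x hx
      · rw [Multiset.eq_of_mem_replicate hx]; exact hd
  · rfl

noncomputable def A (r c n s : ℕ) : ℕ := C n (fun M => Restr r M ∧ c ≤ M.count s)

lemma A_step (r c n s : ℕ) (hr : 2 ≤ r) (hs : 1 ≤ s) (hc : c ≤ r) :
    A r c n s + (if s * c ≤ n then A r (r - c) (n - s * c) s else 0) = e' r n (s * c) := by
  rw [A, C_shift n s c hs, e']
  split_ifs with h
  · have h1 : C (n - s * c) (fun M => Restr r (M + Multiset.replicate c s)) =
        C (n - s * c) (fun M => Restr r M ∧ ¬ (r - c ≤ M.count s)) := by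
      apply C_congr
      intro p
      unfold Restr
      simp only [Multiset.count_add, Multiset.count_replicate]
      constructor
      · intro h
        refine ⟨fun x => by have := h x; omega, ?_⟩
        have := h s
        simp at this
        omega
      · rintro ⟨h1, h2⟩ x
        have := h1 x
        split_ifs with hx
        · subst hx; omega
        · omega
    rw [h1, A, add_comm]
    unfold C
    rw [← Finset.card_filter_add_card_filter_not (s := Finset.univ.filter
      (fun p : (n - s * c).Partition => Restr r p.parts)) (fun p => r - c ≤ p.parts.count s)]
    simp only [Finset.filter_filter]
  · rfl

lemma e'_shift (r n a b : ℕ) (h : a ≤ n) : e' r n (a + b) = e' r (n - a) b := by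
  unfold e'
  rw [Nat.sub_sub]
  congr 1
  simp only [eq_iff_iff]; omega

lemma e'_zero (r n a : ℕ) (h : n < a) : e' r n a = 0 := by
  unfold e'
  rw [if_neg (by omega)]

lemma A_sum (r t s : ℕ) (hr : 2 ≤ r) (hs : 1 ≤ s) (ht1 : 1 ≤ t) (ht2 : t ≤ r - 1) (N : ℕ) :
    ∀ n < N, A r t n s + ∑ j ∈ Finset.range N, e' r n (s * (r * (j + 1))) =
      ∑ j ∈ Finset.range N, e' r n (s * (r * j + t)) := by
  induction N with
  | zero => intro n hn; omega
  | succ N ih =>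
    intro n hn
    rw [Finset.sum_range_succ', Finset.sum_range_succ' (fun j => e' r n (s * (r * j + t)))]
    have hst := A_step r t n s hr hs (by omega)
    have hsr : s * r = s * t + s * (r - t) := by rw [← mul_add]; congr 1; omega
    have hpos : 1 ≤ s * r := Nat.mul_pos hs (by omega)
    by_cases h : s * r ≤ n
    · have h1 : ∀ j, e' r n (s * (r * (j + 1 + 1))) = e' r (n - s * r) (s * (r * (j + 1))) := by
        intro j
        rw [← e'_shift _ _ _ _ h]
        congr 1; ring
      have h2 : ∀ j, e' r n (s * (r * (j + 1) + t)) = e' r (n - s * r) (s * (r * j + t)) := by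
        intro j
        rw [← e'_shift _ _ _ _ h]
        congr 1; ring
      simp only [h1, h2]
      have := ih (n - s * r) (by omega)
      have h3 := A_step r (r - t) (n - s * t) s hr hs (by omega)
      rw [if_pos (by omega)] at h3 hst
      rw [← e'_shift _ _ _ _ (by omega), Nat.sub_sub, ← hsr, Nat.sub_sub_self (by omega)] at h3
      simp only [mul_zero, zero_add, mul_one]
      omega
    · have h1 : ∀ j, e' r n (s * (r * (j + 1))) = 0 := by
        intro j
        apply e'_zero
        have : s * (r * (j + 1)) = s * r + s * r * j := by ring
        have := Nat.zero_le (s * r * j)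
        omega
      have h2 : ∀ j, e' r n (s * (r * (j + 1) + t)) = 0 := by
        intro j
        apply e'_zero
        have : s * (r * (j + 1) + t) = s * r + (s * r * j + s * t) := by ring
        omega
      simp only [h1, h2]
      simp only [mul_zero, zero_add, Finset.sum_const_zero, add_zero]
      by_cases h4 : s * t ≤ n
      · have h3 := A_step r (r - t) (n - s * t) s hr hs (by omega)
        rw [if_pos h4] at hst
        rw [e'_zero _ _ (s * (r - t)) (by omega)] at h3
        omega
      · rw [if_neg h4] at hst
        omega

lemma card_unique (n : ℕ) (P : n.Partition → Prop) (Q : ℕ → ℕ → Multiset ℕ → Prop)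
    (h1 : ∀ p, P p ↔ ∃ k ∈ Finset.Icc 1 n, ∃ m ∈ Finset.Icc 1 n, Q k m p.parts)
    (h2 : ∀ p : n.Partition, ∀ k ∈ Finset.Icc 1 n, ∀ m ∈ Finset.Icc 1 n,
      ∀ k' ∈ Finset.Icc 1 n, ∀ m' ∈ Finset.Icc 1 n,
      Q k m p.parts → Q k' m' p.parts → k = k' ∧ m = m') :
    (Finset.univ.filter P).card = ∑ k ∈ Finset.Icc 1 n, ∑ m ∈ Finset.Icc 1 n, C n (Q k m) := by
  rw [← Finset.sum_product']
  unfold C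
  rw [← Finset.card_biUnion]
  · congr 1
    ext p
    simp only [Finset.mem_filter, Finset.mem_univ, true_and, Finset.mem_biUnion, Finset.mem_product,
      Prod.exists, h1]
    constructor
    · rintro ⟨k, hk, m, hm, h⟩; exact ⟨k, m, ⟨hk, hm⟩, h⟩
    · rintro ⟨k, m, ⟨hk, hm⟩, h⟩; exact ⟨k, hk, m, hm, h⟩
  · rintro ⟨k, m⟩ hkm ⟨k', m'⟩ hkm' hne
    simp only [Finset.mem_coe, Finset.mem_product] at hkm hkm'
    rw [Function.onFun, Finset.disjoint_left]
    intro p hp hp'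
    simp only [Finset.mem_filter, Finset.mem_univ, true_and] at hp hp'
    obtain ⟨rfl, rfl⟩ := h2 p k hkm.1 m hkm.2 k' hkm'.1 m' hkm'.2 hp hp'
    exact hne rfl

lemma count_mul_le {n : ℕ} (p : n.Partition) (s : ℕ) : s * p.parts.count s ≤ n := by
  have h := Multiset.le_count_iff_replicate_le.1 (le_refl (p.parts.count s))
  obtain ⟨u, hu⟩ := Multiset.le_iff_exists_add.1 h
  have := congrArg Multiset.sum hu
  rw [p.parts_sum, Multiset.sum_add, Multiset.sum_replicate, smul_eq_mul, mul_comm] at this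
  omega

lemma count_le {n : ℕ} (p : n.Partition) (s : ℕ) : p.parts.count s ≤ n := by
  rcases Nat.eq_zero_or_pos s with rfl | hs
  · rw [Multiset.count_eq_zero_of_notMem]
    · omega
    · intro h; exact absurd (p.parts_pos h) (by omega)
  · exact le_trans (Nat.le_mul_of_pos_left _ hs) (count_mul_le p s)

lemma card_oneReg (n r : ℕ) (hr : 2 ≤ r) :
    (Finset.univ.filter (fun p : n.Partition => IsOneRegular r p)).card =
      ∑ k ∈ Finset.Icc 1 n, ∑ m ∈ Finset.Icc 1 n, e' r n (k * (r * m)) := by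
  rw [card_unique n _ (fun k m M => (∀ x ∈ M, r ∣ x → x = r * k) ∧ M.count (r * k) = m)]
  · refine Finset.sum_congr rfl fun k hk => Finset.sum_congr rfl fun m hm => ?_
    rw [Finset.mem_Icc] at hk hm
    have hrk : 1 ≤ r * k := Nat.mul_pos (by omega) hk.1
    rw [C_congr n _ (fun M => ((∀ x ∈ M, r ∣ x → x = r * k) ∧ M.count (r * k) = m) ∧
      m ≤ M.count (r * k)), C_shift _ _ _ hrk, e', show k * (r * m) = r * k * m by ring,
      ← C_reg_eq _ _ hr]
    · congr 1
      apply C_congr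
      intro p
      unfold Reg
      simp only [Multiset.count_add, Multiset.count_replicate_self, Multiset.mem_add]
      constructor
      · rintro ⟨h1, h2⟩ x hx hd
        have := h1 x (Or.inl hx) hd
        subst this
        have := Multiset.count_pos.2 hx
        omega
      · intro h
        refine ⟨?_, ?_⟩
        · rintro x (hx | hx) hd
          · exact absurd hd (h x hx)
          · exact Multiset.eq_of_mem_replicate hx
        · rw [Multiset.count_eq_zero_of_notMem]
          · omega
          · intro hx; exact h _ hx ⟨k, rfl⟩
    · intro p
      constructor
      · intro h; exact ⟨h, h.2.ge⟩
      · intro h; exact h.1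
  · intro p
    unfold IsOneRegular
    rw [Finset.card_eq_one]
    constructor
    · rintro ⟨a, ha⟩
      have hmem : ∀ x, (x ∈ p.parts ∧ r ∣ x) ↔ x = a := by
        intro x
        have := Finset.ext_iff.1 ha x
        simpa using this
      obtain ⟨h1, k, rfl⟩ := (hmem a).2 rfl
      have hp := p.parts_pos h1
      have hle := Nat.Partition.le_of_mem_parts h1
      have hk : 1 ≤ k := Nat.pos_of_mul_pos_left hp
      have := Nat.le_mul_of_pos_left k (show 0 < r by omega)
      refine ⟨k, Finset.mem_Icc.2 ⟨hk, by omega⟩, p.parts.count (r * k),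
        Finset.mem_Icc.2 ⟨Multiset.count_pos.2 h1, count_le p _⟩, fun x hx hd => (hmem x).1 ⟨hx, hd⟩, rfl⟩
    · rintro ⟨k, hk, m, hm, h1, h2⟩
      rw [Finset.mem_Icc] at hk hm
      refine ⟨r * k, ?_⟩
      ext x
      simp only [Finset.mem_filter, Multiset.mem_toFinset, Finset.mem_singleton]
      constructor
      · rintro ⟨hx, hd⟩; exact h1 x hx hd
      · rintro rfl
        exact ⟨Multiset.count_pos.1 (by omega), k, rfl⟩
  · rintro p k hk m hm k' hk' m' hm' ⟨h1, h2⟩ ⟨h3, h4⟩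
    rw [Finset.mem_Icc] at hk hm hk' hm'
    have := h3 (r * k) (Multiset.count_pos.1 (by omega)) ⟨k, rfl⟩
    have : k = k' := Nat.eq_of_mul_eq_mul_left (by omega) this
    subst this
    exact ⟨rfl, by omega⟩

lemma card_oneRestr (n r : ℕ) (hr : 2 ≤ r) :
    (Finset.univ.filter (fun p : n.Partition => IsOneRestricted r p)).card =
      ∑ k ∈ Finset.Icc 1 n, ∑ m ∈ Finset.Icc 1 n, e' r n (k * (r * m)) := by
  rw [card_unique n _ (fun k m M => (∀ x, x ≠ k → M.count x < r) ∧ M.count k / r = m)]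
  · refine Finset.sum_congr rfl fun k hk => Finset.sum_congr rfl fun m hm => ?_
    rw [Finset.mem_Icc] at hk hm
    rw [C_congr n _ (fun M => ((∀ x, x ≠ k → M.count x < r) ∧ M.count k / r = m) ∧
      r * m ≤ M.count k), C_shift _ _ _ hk.1, e']
    · congr 1
      apply C_congr
      intro p
      unfold Restr
      simp only [Multiset.count_add, Multiset.count_replicate]
      rw [if_pos trivial, Nat.add_mul_div_left _ _ (show 0 < r by omega)]
      constructor
      · rintro ⟨h1, h2⟩ x
        by_cases hx : x = k
        · subst hx
          have : p.parts.count x / r = 0 := by omega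
          rcases Nat.div_eq_zero_iff.1 this with h | h <;> omega
        · have := h1 x hx
          omega
      · intro h
        refine ⟨fun x hx => ?_, ?_⟩
        · rw [if_neg (Ne.symm hx)]
          have := h x; omega
        · have := h k
          rw [Nat.div_eq_of_lt (by omega)]; omega
    · intro p
      constructor
      · intro h; refine ⟨h, ?_⟩
        rw [← h.2]
        exact Nat.mul_div_le _ _
      · intro h; exact h.1
  · intro p
    unfold IsOneRestricted
    rw [Finset.card_eq_one]
    constructor
    · rintro ⟨k, ha⟩
      have hmem : ∀ x, (x ∈ p.parts ∧ r ≤ p.parts.count x) ↔ x = k := by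
        intro x
        have := Finset.ext_iff.1 ha x
        simpa using this
      obtain ⟨h1, h2⟩ := (hmem k).2 rfl
      have hp := p.parts_pos h1
      have hle := Nat.Partition.le_of_mem_parts h1
      refine ⟨k, Finset.mem_Icc.2 ⟨hp, hle⟩, p.parts.count k / r,
        Finset.mem_Icc.2 ⟨Nat.div_pos h2 (by omega), (Nat.div_le_self _ _).trans (count_le p _)⟩,
          fun x hx => ?_, rfl⟩
      by_contra hc
      exact hx ((hmem x).1 ⟨Multiset.count_pos.1 (by omega), by omega⟩)
    · rintro ⟨k, hk, m, hm, h1, h2⟩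
      rw [Finset.mem_Icc] at hk hm
      refine ⟨k, ?_⟩
      ext x
      simp only [Finset.mem_filter, Multiset.mem_toFinset, Finset.mem_singleton]
      constructor
      · rintro ⟨hx, hd⟩
        by_contra hc
        have := h1 x hc
        omega
      · rintro rfl
        have : r ≤ p.parts.count x := by
          by_contra hc
          rw [Nat.div_eq_of_lt (by omega)] at h2
          omega
        exact ⟨Multiset.count_pos.1 (by omega), this⟩
  · rintro p k hk m hm k' hk' m' hm' ⟨h1, h2⟩ ⟨h3, h4⟩
    rw [Finset.mem_Icc] at hk hm hk' hm'
    have : k = k' := by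
      by_contra hc
      have := h3 k hc
      rw [Nat.div_eq_of_lt (by omega)] at h2
      omega
    subst this
    exact ⟨rfl, by omega⟩

lemma sum_lRep (n r t : ℕ) (ht1 : 1 ≤ t) :
    ∑ p ∈ Finset.univ.filter (fun p : n.Partition => IsRestricted r p), lRep t p =
      ∑ s ∈ Finset.Icc 1 n, A r t n s := by
  have h : ∀ p : n.Partition, lRep t p =
      ∑ s ∈ Finset.Icc 1 n, if t ≤ p.parts.count s then 1 else 0 := by
    intro p
    rw [← Finset.card_filter]
    unfold lRep
    congr 1
    ext x
    simp only [Finset.mem_filter, Multiset.mem_toFinset, Finset.mem_Icc]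
    constructor
    · rintro ⟨h1, h2⟩
      exact ⟨⟨p.parts_pos h1, Nat.Partition.le_of_mem_parts h1⟩, h2⟩
    · rintro ⟨h1, h2⟩
      exact ⟨Multiset.count_pos.1 (by omega), h2⟩
  simp only [h]
  rw [Finset.sum_comm]
  refine Finset.sum_congr rfl fun s _ => ?_
  rw [← Finset.card_filter, Finset.filter_filter]
  unfold A C
  congr 1
  ext p
  simp only [Finset.mem_filter]
  rfl

lemma sum_lMod (n r t : ℕ) (hr : 2 ≤ r) (ht1 : 1 ≤ t) (ht2 : t ≤ r - 1) :
    ∑ p ∈ Finset.univ.filter (fun p : n.Partition => IsRegular r p), lMod r t p =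
      ∑ u ∈ (Finset.Icc 1 n).filter (fun u => u % r = t),
        ∑ j ∈ Finset.Icc 1 n, e' r n (u * j) := by
  have h : ∀ p : n.Partition, lMod r t p =
      ∑ u ∈ (Finset.Icc 1 n).filter (fun u => u % r = t), ∑ j ∈ Finset.Icc 1 n,
        if j ≤ p.parts.count u then 1 else 0 := by
    intro p
    have h1 : ∀ u, (∑ j ∈ Finset.Icc 1 n, if j ≤ p.parts.count u then 1 else 0) =
        p.parts.count u := by
      intro u
      rw [← Finset.card_filter]
      have : (Finset.Icc 1 n).filter (fun j => j ≤ p.parts.count u) =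
          Finset.Icc 1 (p.parts.count u) := by
        ext j
        have := count_le p u
        simp only [Finset.mem_filter, Finset.mem_Icc]
        omega
      rw [this]; simp
    simp only [h1]
    unfold lMod
    rw [Nat.mod_eq_of_lt (show t < r by omega)]
    rw [← Multiset.sum_count_eq_card (s := (Finset.Icc 1 n).filter (fun u => u % r = t))]
    · refine Finset.sum_congr rfl fun u hu => ?_
      rw [Multiset.count_filter_of_pos (p := fun x => x % r = t) (Finset.mem_filter.1 hu).2]
    · intro a ha
      rw [Multiset.mem_filter] at ha
      rw [Finset.mem_filter, Finset.mem_Icc]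
      exact ⟨⟨p.parts_pos ha.1, Nat.Partition.le_of_mem_parts ha.1⟩, ha.2⟩
  simp only [h]
  rw [Finset.sum_comm]
  refine Finset.sum_congr rfl fun u hu => ?_
  rw [Finset.sum_comm]
  refine Finset.sum_congr rfl fun j _ => ?_
  rw [Finset.mem_filter, Finset.mem_Icc] at hu
  rw [← C_reg_shift r n u j hr hu.1.1]
  · rw [← Finset.card_filter, Finset.filter_filter]
    unfold C
    congr 1
    ext p
    simp only [Finset.mem_filter]
    rfl
  · intro hd
    have := Nat.mod_eq_zero_of_dvd hd
    omega

lemma reindex1 (n r s : ℕ) (hr : 2 ≤ r) (hs : 1 ≤ s) :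
    ∑ j ∈ Finset.range (n + 1), e' r n (s * (r * (j + 1))) =
      ∑ m ∈ Finset.Icc 1 n, e' r n (s * (r * m)) := by
  rw [Finset.sum_range_succ, e'_zero r n (s * (r * (n + 1))), add_zero]
  · rw [Finset.range_eq_Ico, Finset.sum_Ico_add' (fun m => e' r n (s * (r * m)))]
    rfl
  · have h1 := Nat.le_mul_of_pos_left (n + 1) (show 0 < r by omega)
    have h2 := Nat.le_mul_of_pos_left (r * (n + 1)) (show 0 < s by omega)
    omega

lemma reindex2 (n r t s : ℕ) (hr : 2 ≤ r) (hs : 1 ≤ s) (ht1 : 1 ≤ t) (ht2 : t ≤ r - 1) :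
    ∑ j ∈ Finset.range (n + 1), e' r n (s * (r * j + t)) =
      ∑ u ∈ (Finset.Icc 1 n).filter (fun u => u % r = t), e' r n (s * u) := by
  symm
  refine Finset.sum_of_injOn (fun u => u / r) ?_ ?_ ?_ ?_
  · intro a ha b hb hab
    simp only [Finset.coe_filter, Finset.mem_Icc, Set.mem_ofPred_eq] at ha hb hab
    rw [← Nat.div_add_mod a r, ← Nat.div_add_mod b r, hab, ha.2, hb.2]
  · intro a ha
    simp only [Finset.coe_filter, Finset.mem_Icc, Set.mem_ofPred_eq] at ha
    have := Nat.div_le_self a r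
    simp only [Finset.coe_range, Set.mem_Iio]
    omega
  · intro j hj hj'
    apply e'_zero
    by_contra hc
    have h2 := Nat.le_mul_of_pos_left (r * j + t) (show 0 < s by omega)
    apply hj'
    refine ⟨r * j + t, ?_, ?_⟩
    · simp only [Finset.coe_filter, Finset.mem_Icc, Set.mem_ofPred_eq]
      refine ⟨by omega, ?_⟩
      rw [Nat.mul_add_mod, Nat.mod_eq_of_lt (by omega)]
    · simp only
      rw [Nat.mul_add_div (by omega), Nat.div_eq_of_lt (by omega), add_zero]
  · intro u hu
    rw [Finset.mem_filter] at hu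
    have := Nat.div_add_mod u r
    rw [hu.2] at this
    simp only [this]

theorem beck_third (n r t : ℕ) (hr : 2 ≤ r) (ht1 : 1 ≤ t) (ht2 : t ≤ r - 1) :
    (Finset.univ.filter (fun p : n.Partition => IsOneRegular r p)).card = (Finset.univ.filter (fun p : n.Partition => IsOneRestricted r p)).card ∧
    ((Finset.univ.filter (fun p : n.Partition => IsOneRegular r p)).card : ℤ) =
      (∑ p ∈ Finset.univ.filter (fun p : n.Partition => IsRegular r p), (lMod r t p : ℤ)) -
      ∑ p ∈ Finset.univ.filter (fun p : n.Partition => IsRestricted r p), (lRep t p : ℤ) := by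
  have h1 := card_oneReg n r hr
  refine ⟨h1.trans (card_oneRestr n r hr).symm, ?_⟩
  rw [eq_sub_iff_add_eq]
  rw [← Nat.cast_sum, ← Nat.cast_sum, ← Nat.cast_add, Nat.cast_inj]
  rw [h1, sum_lRep n r t ht1, sum_lMod n r t hr ht1 ht2, Finset.sum_comm (s := Finset.filter _ _),
    ← Finset.sum_add_distrib]
  refine Finset.sum_congr rfl fun s hs => ?_
  rw [Finset.mem_Icc] at hs
  have h2 := A_sum r t s hr hs.1 ht1 ht2 (n + 1) n (by omega)
  rw [reindex1 n r s hr hs.1, reindex2 n r t s hr hs.1 ht1 ht2] at h2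
  rw [add_comm, h2]
  refine Finset.sum_congr rfl fun u _ => ?_
  rw [mul_comm]

end BeckPaper
end

section
/- Let n ≥ 0 and r ≥ 2 be integers. Then b_r(n) = (r−1)·|O_{1,r}(n)| = (r−1)·|D_{1,r}(n)|, where b_r(n) is the excess of the total number of parts in all r-regular partitions of n over the total number of parts in all partitions of n with no part repeated more than r−1 times. -/
open scoped Classical

namespace BeckPaper

section BeckAux
open PowerSeries Finset
open scoped PowerSeries.WithPiTopology

variable {R : Type*} [CommRing R]

noncomputable def linW (a : ℕ → R) (i c : ℕ) : R := if c = 1 then - a i else 0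

noncomputable def markW (z e : R) (P : ℕ → ℕ → Prop) (i c : ℕ) : R :=
  if P i c ∧ c ≠ 0 then e else z ^ c

theorem genFun_linW_hasProd [TopologicalSpace R] [T2Space R] (a : ℕ → R) :
    HasProd (fun i ↦ 1 - a (i + 1) • (X : R⟦X⟧) ^ (i + 1)) (Nat.Partition.genFun (linW a)) := by
  convert! Nat.Partition.hasProd_genFun (linW a) using 1
  ext1 i
  rw [tsum_eq_single 0]
  · simp [linW, sub_eq_add_neg]
  · intro b hb
    simp [linW, hb]

theorem genFun_mul_linW (f h : ℕ → ℕ → R) (a : ℕ → R) (hf : ∀ i, f i 0 = 1)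
    (hh : ∀ i c, 0 < i → h i (c + 1) = f i (c + 1) - a i * f i c) :
    Nat.Partition.genFun f * Nat.Partition.genFun (linW a) = Nat.Partition.genFun h := by
  let _ : TopologicalSpace R := ⊥
  have _ : DiscreteTopology R := ⟨rfl⟩
  have h1 := (Nat.Partition.hasProd_genFun f).mul (genFun_linW_hasProd a)
  refine h1.unique ?_
  convert! Nat.Partition.hasProd_genFun h using 1
  ext1 i
  have hs := (Nat.Partition.summable_genFun_term f i).hasSum
  have hs0 : HasSum (fun j ↦ f (i + 1) j • (X : R⟦X⟧) ^ ((i + 1) * j))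
      (1 + ∑' j, f (i + 1) (j + 1) • (X : R⟦X⟧) ^ ((i + 1) * (j + 1))) := by
    have := hs.zero_add (f := fun j ↦ f (i + 1) j • (X : R⟦X⟧) ^ ((i + 1) * j))
    simpa [hf] using this
  have hs1 := hs0.mul_right (a (i + 1) • (X : R⟦X⟧) ^ (i + 1))
  have hs2 := hs.sub hs1
  rw [mul_sub, mul_one, add_sub_assoc, ← hs2.tsum_eq]
  congr 1
  refine tsum_congr fun j ↦ ?_
  rw [hh _ _ (Nat.succ_pos i), sub_smul, smul_mul_smul_comm, ← pow_add, mul_comm (a _)]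
  congr 2

theorem genFun_reindex (r : ℕ) (hr : 0 < r) (b : R) :
    Nat.Partition.genFun (fun _ c ↦ if c = r then -b else 0) =
      Nat.Partition.genFun (linW (fun i ↦ if r ∣ i then b else 0)) := by
  let _ : TopologicalSpace R := ⊥
  have _ : DiscreteTopology R := ⟨rfl⟩
  rw [← (genFun_linW_hasProd _).tprod_eq, Nat.Partition.genFun_eq_tprod]
  have hl : ∀ i : ℕ, 1 + ∑' j, (if j + 1 = r then -b else 0) • (X : R⟦X⟧) ^ ((i + 1) * (j + 1))
      = 1 - b • X ^ ((i + 1) * r) := by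
    intro i
    rw [tsum_eq_single (r - 1)]
    · simp [Nat.sub_add_cancel hr, sub_eq_add_neg]
    · intro j hj
      rw [if_neg (by omega), zero_smul]
  simp_rw [hl]
  symm
  refine tprod_eq_tprod_of_ne_one_bij (fun i ↦ (i.val + 1) * r - 1) ?_ ?_ ?_
  · intro x y h
    rw [tsub_left_inj (by nlinarith) (by nlinarith), mul_left_inj' (hr.ne.symm), add_left_inj] at h
    exact SetCoe.ext h
  · intro i hi
    have hd : r ∣ i + 1 := by
      by_contra hd
      simp [hd] at hi
    obtain ⟨j, hj⟩ := hd
    have hj0 : j ≠ 0 := by rintro rfl; simp at hj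
    have hj1 : j - 1 + 1 = j := by omega
    have hj2 : j * r = i + 1 := by rw [hj, mul_comm]
    refine ⟨⟨j - 1, ?_⟩, ?_⟩
    · rw [Function.mem_mulSupport] at hi ⊢
      rw [hj1, hj2]
      simpa [Dvd.intro j hj.symm] using hi
    · simp only [hj1, hj2]
      omega
  · intro i
    have : (i.val + 1) * r - 1 + 1 = (i.val + 1) * r := Nat.sub_add_cancel (by nlinarith)
    simp [this]

theorem genFun_markO (r : ℕ) (z e : R) (he : z * e = e) :
    Nat.Partition.genFun (markW z e (fun i _ ↦ r ∣ i)) * Nat.Partition.genFun (linW fun _ ↦ z) =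
      Nat.Partition.genFun (linW (fun i ↦ if r ∣ i then z - e else 0)) := by
  apply genFun_mul_linW
  · simp [markW]
  · intro i c _
    by_cases hd : r ∣ i
    · rcases Nat.eq_zero_or_pos c with rfl | hc
      · simp [markW, linW, hd]
      · simp [markW, linW, hd, hc.ne', he]
    · simp [markW, linW, hd, pow_succ, mul_comm]

theorem genFun_markD (r : ℕ) (hr : 2 ≤ r) (z e : R) (he : z * e = e) :
    Nat.Partition.genFun (markW z e (fun _ c ↦ r ≤ c)) * Nat.Partition.genFun (linW fun _ ↦ z) =
      Nat.Partition.genFun (linW (fun i ↦ if r ∣ i then z ^ r - e else 0)) := by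
  rw [← genFun_reindex r (by omega)]
  apply genFun_mul_linW
  · simp [markW]
  · intro i c _
    rcases lt_trichotomy (c + 1) r with h | h | h
    · have h1 : ¬ r ≤ c + 1 := by omega
      have h2 : ¬ r ≤ c := by omega
      simp [markW, h1, h2, h.ne, pow_succ, mul_comm]
    · subst h
      simp [markW, pow_succ, mul_comm]
    · have h1 : r ≤ c + 1 := by omega
      have h2 : r ≤ c := by omega
      have h3 : c ≠ 0 := by omega
      simp [markW, h1, h2, h.ne', h3, he]

theorem isUnit_genFun (f : ℕ → ℕ → R) : IsUnit (Nat.Partition.genFun f) := by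
  rw [PowerSeries.isUnit_iff_constantCoeff, ← PowerSeries.coeff_zero_eq_constantCoeff_apply,
    Nat.Partition.coeff_genFun]
  have : ∀ p : Nat.Partition 0, p.parts.toFinsupp.prod f = 1 := by
    intro p
    have : p.parts = 0 := by
      rw [Subsingleton.elim p (Nat.Partition.indiscrete 0)]; simp
    simp [this]
  simp [this]

theorem map_genFun {S : Type*} [CommRing S] (φ : R →+* S) (f : ℕ → ℕ → R) :
    PowerSeries.map φ (Nat.Partition.genFun f) = Nat.Partition.genFun (fun i c ↦ φ (f i c)) := by
  ext n
  simp [Finsupp.prod]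

theorem one_add_eps_pow (k : ℕ) : (1 + DualNumber.eps : DualNumber ℤ) ^ k = 1 + k • DualNumber.eps := by
  induction k with
  | zero => simp
  | succ k ih =>
    rw [pow_succ, ih]
    have := DualNumber.eps_mul_eps (R := ℤ)
    simp only [nsmul_eq_mul]
    push_cast
    linear_combination (k : DualNumber ℤ) * this

/-- the ring map `a + bε ↦ a + tbε` -/
noncomputable def scaleHom (t : ℤ) : DualNumber ℤ →+* DualNumber ℤ where
  toFun x := ((x.fst, t * x.snd) : ℤ × ℤ)
  map_one' := by
    apply TrivSqZeroExt.ext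
    · rfl
    · change t * (1 : DualNumber ℤ).snd = (1 : DualNumber ℤ).snd
      simp
  map_zero' := by
    apply TrivSqZeroExt.ext
    · rfl
    · change t * (0 : DualNumber ℤ).snd = (0 : DualNumber ℤ).snd
      simp
  map_mul' x y := by
    apply TrivSqZeroExt.ext
    · rfl
    · change t * (x * y).snd = x.fst • (t * y.snd) + MulOpposite.op y.fst • (t * x.snd)
      simp
      ring
  map_add' x y := by
    apply TrivSqZeroExt.ext
    · rfl
    · change t * (x + y).snd = t * x.snd + t * y.snd
      simp [mul_add]

theorem scaleHom_fst (t : ℤ) (x : DualNumber ℤ) : (scaleHom t x).fst = x.fst := rfl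

theorem scaleHom_snd (t : ℤ) (x : DualNumber ℤ) : (scaleHom t x).snd = t * x.snd := rfl

noncomputable def bigM (r : ℕ) (t : ℤ) : (DualNumber ℤ)⟦X⟧ :=
  Nat.Partition.genFun (linW (fun i ↦ if r ∣ i then (1 + t • DualNumber.eps) else 0))

theorem bigM_eq (r : ℕ) (t : ℤ) : bigM r t = PowerSeries.map (scaleHom t) (bigM r 1) := by
  rw [bigM, bigM, map_genFun]
  congr 1
  ext1 i
  ext1 c
  have : scaleHom t DualNumber.eps = t • DualNumber.eps := by
    apply TrivSqZeroExt.ext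
    · change (DualNumber.eps : DualNumber ℤ).fst = _
      simp
    · change t * (DualNumber.eps : DualNumber ℤ).snd = _
      simp
  unfold linW
  by_cases hc : c = 1 <;> by_cases hd : r ∣ i <;> simp [this, hc, hd]

theorem bigM_lin (r : ℕ) (s t u v k : ℤ) (h : s - t = k * (u - v)) :
    bigM r s - bigM r t = k • (bigM r u - bigM r v) := by
  rw [bigM_eq r s, bigM_eq r t, bigM_eq r u, bigM_eq r v]
  ext n
  · simp only [map_sub, coeff_map, TrivSqZeroExt.fst_sub, map_zsmul, TrivSqZeroExt.fst_smul]
    simp [scaleHom_fst]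
  · simp only [map_sub, coeff_map, TrivSqZeroExt.snd_sub, map_zsmul, TrivSqZeroExt.snd_smul]
    simp only [scaleHom_snd, smul_eq_mul]
    linear_combination (coeff n (bigM r 1)).snd * h

noncomputable def zz : DualNumber ℤ := 1 + DualNumber.eps

theorem key (r : ℕ) (hr : 2 ≤ r) :
    Nat.Partition.genFun (markW zz 0 (fun i _ ↦ r ∣ i)) -
      Nat.Partition.genFun (markW zz 0 (fun _ c ↦ r ≤ c)) =
      ((r : ℤ) - 1) • (Nat.Partition.genFun (markW zz DualNumber.eps (fun i _ ↦ r ∣ i)) -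
        Nat.Partition.genFun (markW zz 0 (fun i _ ↦ r ∣ i))) ∧
    Nat.Partition.genFun (markW zz 0 (fun i _ ↦ r ∣ i)) -
      Nat.Partition.genFun (markW zz 0 (fun _ c ↦ r ≤ c)) =
      ((r : ℤ) - 1) • (Nat.Partition.genFun (markW zz DualNumber.eps (fun _ c ↦ r ≤ c)) -
        Nat.Partition.genFun (markW zz 0 (fun _ c ↦ r ≤ c))) := by
  have he : zz * DualNumber.eps = DualNumber.eps := by
    simp [zz, add_mul]
  have hA := genFun_markO r zz 0 (by simp)
  have hB := genFun_markD r hr zz 0 (by simp)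
  have hC := genFun_markO r zz _ he
  have hD := genFun_markD r hr zz _ he
  have e1 : zz - 0 = 1 + (1 : ℤ) • DualNumber.eps := by simp [zz]
  have e2 : zz ^ r - 0 = 1 + (r : ℤ) • DualNumber.eps := by
    rw [zz, one_add_eps_pow]; simp
  have e3 : zz - DualNumber.eps = 1 + (0 : ℤ) • DualNumber.eps := by simp [zz]
  have e4 : zz ^ r - DualNumber.eps = 1 + ((r : ℤ) - 1) • DualNumber.eps := by
    rw [zz, one_add_eps_pow, sub_smul]; simp; ring
  rw [e1] at hA
  rw [e2] at hB
  rw [e3] at hC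
  rw [e4] at hD
  change _ = bigM r _ at hA hB hC hD
  have hu := isUnit_genFun (linW fun _ ↦ zz)
  constructor
  · apply hu.mul_right_cancel
    rw [smul_mul_assoc, sub_mul, sub_mul, hA, hB, hC]
    exact bigM_lin _ _ _ _ _ _ (by ring)
  · apply hu.mul_right_cancel
    rw [smul_mul_assoc, sub_mul, sub_mul, hA, hB, hD]
    exact bigM_lin _ _ _ _ _ _ (by ring)

theorem prod_markW (e : DualNumber ℤ) {n : ℕ} (p : n.Partition) (P : ℕ → ℕ → Prop) :
    ∃ m, p.parts.toFinsupp.prod (markW zz e P) =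
      e ^ (p.parts.toFinset.filter (fun s => P s (p.parts.count s))).card * zz ^ m ∧
      ((p.parts.toFinset.filter (fun s => P s (p.parts.count s))).card = 0 → m = numParts p) := by
  refine ⟨∑ i ∈ p.parts.toFinset.filter (fun s => ¬ P s (p.parts.count s)), p.parts.count i, ?_, ?_⟩
  · rw [Finsupp.prod, ← Finset.prod_pow_eq_pow_sum, ← Finset.prod_const, ← Finset.prod_ite]
    refine Finset.prod_congr (by simp) fun i hi ↦ ?_
    have : p.parts.count i ≠ 0 := by simpa using hi
    simp only [markW, Multiset.toFinsupp_apply, this, ne_eq, not_false_eq_true, and_true]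
  · intro h
    rw [Finset.card_eq_zero, Finset.filter_eq_empty_iff] at h
    rw [Finset.filter_true_of_mem (fun x hx ↦ h hx), Multiset.toFinset_sum_count_eq]
    rfl

theorem snd_zero (n : ℕ) (P : ℕ → ℕ → Prop) (Q : n.Partition → Prop)
    (hQ : ∀ p, Q p ↔ (p.parts.toFinset.filter (fun s => P s (p.parts.count s))).card = 0) :
    (coeff n (Nat.Partition.genFun (markW zz 0 P))).snd =
      ∑ p ∈ Finset.univ.filter Q, (numParts p : ℤ) := by
  rw [Nat.Partition.coeff_genFun, TrivSqZeroExt.snd_sum, Finset.sum_filter]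
  refine Finset.sum_congr rfl fun p _ ↦ ?_
  obtain ⟨m, h1, h2⟩ := prod_markW 0 p P
  rw [h1]
  by_cases h : Q p
  · have h0 := (hQ p).1 h
    rw [if_pos h, h0, h2 h0, zz, one_add_eps_pow]
    simp
  · rw [if_neg h, zero_pow (fun h' ↦ h ((hQ p).2 h'))]
    simp

theorem snd_eps (n : ℕ) (P : ℕ → ℕ → Prop) (Q : n.Partition → Prop)
    (hQ : ∀ p, Q p ↔ (p.parts.toFinset.filter (fun s => P s (p.parts.count s))).card = 1) :
    (coeff n (Nat.Partition.genFun (markW zz DualNumber.eps P) -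
      Nat.Partition.genFun (markW zz 0 P))).snd = (Finset.univ.filter Q).card := by
  rw [map_sub, Nat.Partition.coeff_genFun, Nat.Partition.coeff_genFun, ← Finset.sum_sub_distrib,
    TrivSqZeroExt.snd_sum, Finset.card_filter]
  push_cast
  refine Finset.sum_congr rfl fun p _ ↦ ?_
  obtain ⟨m, h1, h2⟩ := prod_markW 0 p P
  obtain ⟨m', h1', h2'⟩ := prod_markW DualNumber.eps p P
  rw [h1, h1']
  have hQp := hQ p
  generalize (p.parts.toFinset.filter (fun s => P s (p.parts.count s))).card = k at *
  match k with
  | 0 => simp [hQp, h2 rfl, h2' rfl]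
  | 1 => rw [zz, one_add_eps_pow]; simp [hQp]
  | k + 2 =>
    have : (DualNumber.eps : DualNumber ℤ) ^ (k + 2) = 0 := by
      rw [pow_add, pow_two, DualNumber.eps_mul_eps, mul_zero]
    simp [this, hQp]

end BeckAux

theorem beck_first (n r : ℕ) (hr : 2 ≤ r) :
    ((∑ p ∈ Finset.univ.filter (fun p : n.Partition => IsRegular r p), (numParts p : ℤ)) -
        ∑ p ∈ Finset.univ.filter (fun p : n.Partition => IsRestricted r p), (numParts p : ℤ)) =
        ((r : ℤ) - 1) * (Finset.univ.filter (fun p : n.Partition => IsOneRegular r p)).card ∧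
    ((∑ p ∈ Finset.univ.filter (fun p : n.Partition => IsRegular r p), (numParts p : ℤ)) -
        ∑ p ∈ Finset.univ.filter (fun p : n.Partition => IsRestricted r p), (numParts p : ℤ)) =
        ((r : ℤ) - 1) * (Finset.univ.filter (fun p : n.Partition => IsOneRestricted r p)).card := by
  obtain ⟨h1, h2⟩ := key r hr
  have hA := snd_zero n (fun i _ ↦ r ∣ i) (fun p ↦ IsRegular r p) (by
    intro p
    simp [IsRegular, Finset.filter_eq_empty_iff])
  have hB := snd_zero n (fun _ c ↦ r ≤ c) (fun p ↦ IsRestricted r p) (by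
    intro p
    simp only [IsRestricted, Finset.card_eq_zero, Finset.filter_eq_empty_iff,
      Multiset.mem_toFinset]
    constructor
    · intro h x _
      have := h x
      omega
    · intro h x
      by_cases hx : x ∈ p.parts
      · have := h hx
        omega
      · simp [Multiset.count_eq_zero_of_notMem hx])
  have hC := snd_eps n (fun i _ ↦ r ∣ i) (fun p ↦ IsOneRegular r p) (by
    intro p
    unfold IsOneRegular
    congr!)
  have hD := snd_eps n (fun _ c ↦ r ≤ c) (fun p ↦ IsOneRestricted r p) (by
    intro p
    unfold IsOneRestricted
    congr!)
  have g1 := congrArg (fun F ↦ (PowerSeries.coeff n F).snd) h1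
  have g2 := congrArg (fun F ↦ (PowerSeries.coeff n F).snd) h2
  simp only [map_zsmul, TrivSqZeroExt.snd_smul, hC, hD] at g1 g2
  rw [map_sub, TrivSqZeroExt.snd_sub, hA, hB] at g1 g2
  exact ⟨g1, g2⟩


end BeckPaper
end

section
/- Let n ≥ 0, r ≥ 2 and 1 ≤ t ≤ r−1 be integers. Then E_{r,t}(n) = Σ_{λ∈F_r(n)} (ℓ_t(λ) − d_t(λ)), i.e., the excess of the number of parts congruent to t mod r in all r-regular partitions of n over the number of different part sizes appearing at least t times in all partitions of n with no part repeated more than r−1 times equals the number of parts congruent to t mod r in all r-flat partitions of n minus the number of consecutive differences that are at least t in all r-flat partitions of n (as an integer; this summand may be negative for individual partitions). -/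
open scoped Classical

namespace BeckPaper

/-- number of entries at least `i` -/
def cc (s : Multiset ℕ) (i : ℕ) : ℕ := Multiset.card (s.filter (fun x => i ≤ x))

def pt (s : Multiset ℕ) (i : ℕ) : ℕ := (s.sort (· ≥ ·)).getD (i - 1) 0

def cj (s : Multiset ℕ) : Multiset ℕ :=
  ((Finset.Icc 1 s.sum).val.map (cc s)).filter (fun x => x ≠ 0)

def Pos (s : Multiset ℕ) : Prop := ∀ x ∈ s, 0 < x

noncomputable def MM (n : ℕ) : Finset (Multiset ℕ) :=
  (Finset.univ : Finset n.Partition).image (fun p => p.parts)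

lemma mem_MM {n : ℕ} {s : Multiset ℕ} : s ∈ MM n ↔ Pos s ∧ s.sum = n := by
  unfold MM Pos
  simp only [Finset.mem_image, Finset.mem_univ, true_and]
  constructor
  · rintro ⟨p, rfl⟩
    exact ⟨fun x hx => p.parts_pos hx, p.parts_sum⟩
  · rintro ⟨h1, h2⟩
    exact ⟨⟨s, fun {i} hi => h1 i hi, h2⟩, rfl⟩

lemma sum_MM {n : ℕ} (f : Multiset ℕ → ℤ) (Q : Multiset ℕ → Prop) :
    ∑ p ∈ Finset.univ.filter (fun p : n.Partition => Q p.parts), f p.parts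
      = ∑ s ∈ (MM n).filter Q, f s := by
  unfold MM
  rw [Finset.filter_image, Finset.sum_image]
  intro p _ q _ h
  exact Nat.Partition.ext h

lemma list_galois (l : List ℕ) (hl : l.Pairwise (· ≥ ·)) (i : ℕ) (hi : 1 ≤ i) (j : ℕ) :
    i ≤ l.getD j 0 ↔ j < (l.filter (fun x => decide (i ≤ x))).length := by
  induction l generalizing j with
  | nil => simp; omega
  | cons a l ih =>
    rw [List.pairwise_cons] at hl
    by_cases h : i ≤ a
    · cases j with
      | zero => simp [h]
      | succ j => simp [h, ← ih hl.2 j]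
    · have h0 : l.filter (fun x => decide (i ≤ x)) = [] := by
        rw [List.filter_eq_nil_iff]
        intro x hx
        have := hl.1 x hx
        simp; omega
      have := ih hl.2
      cases j with
      | zero => simp [h, h0]
      | succ j =>
        have := ih hl.2 j
        rw [h0] at this
        simp at this
        simp [h, h0]
        omega

lemma galois (s : Multiset ℕ) {i j : ℕ} (hi : 1 ≤ i) (hj : 1 ≤ j) :
    i ≤ pt s j ↔ j ≤ cc s i := by
  have := list_galois (s.sort (· ≥ ·)) (Multiset.pairwise_sort s _) i hi (j - 1)
  unfold pt
  rw [this]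
  have h2 : (List.filter (fun x => decide (i ≤ x)) (s.sort (· ≥ ·))).length = cc s i := by
    unfold cc
    conv_rhs => rw [← Multiset.sort_eq s (· ≥ ·)]
    rw [Multiset.filter_coe, Multiset.coe_card]
  rw [h2]; omega

lemma cc_eq_zero (s : Multiset ℕ) {i : ℕ} (hi : s.sum < i) : cc s i = 0 := by
  unfold cc
  rw [Multiset.card_eq_zero, Multiset.filter_eq_nil]
  intro x hx
  have := Multiset.le_sum_of_mem hx
  omega

lemma cc_add (s t : Multiset ℕ) (i : ℕ) : cc (s + t) i = cc s i + cc t i := by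
  simp [cc, Multiset.filter_add]

lemma cc_nsmul (s : Multiset ℕ) (k i : ℕ) : cc (k • s) i = k * cc s i := by
  simp [cc, Multiset.filter_nsmul]

lemma sum_cc (s : Multiset ℕ) (N : ℕ) (h : ∀ x ∈ s, x ≤ N) :
    ∑ i ∈ Finset.Icc 1 N, cc s i = s.sum := by
  induction s using Multiset.induction_on with
  | empty => simp [cc]
  | cons a s ih =>
    have e : ∀ i, cc (a ::ₘ s) i = (if i ≤ a then 1 else 0) + cc s i := by
      intro i
      by_cases h : i ≤ a <;> simp [cc, h, add_comm]
    simp_rw [e]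
    rw [Finset.sum_add_distrib, ih (fun x hx => h x (Multiset.mem_cons_of_mem hx)),
      Multiset.sum_cons, ← Finset.card_filter]
    congr 1
    have ha := h a (Multiset.mem_cons_self a s)
    have : (Finset.Icc 1 N).filter (fun i => i ≤ a) = Finset.Icc 1 a := by
      ext i; simp; omega
    rw [this]; simp

lemma count_eq (s : Multiset ℕ) (i : ℕ) : s.count i + cc s (i + 1) = cc s i := by
  induction s using Multiset.induction_on with
  | empty => simp [cc]
  | cons a s ih =>
    have e : ∀ i, cc (a ::ₘ s) i = (if i ≤ a then 1 else 0) + cc s i := by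
      intro i
      by_cases h : i ≤ a <;> simp [cc, h, add_comm]
    rw [Multiset.count_cons, e, e]
    split_ifs <;> omega

lemma ext_cc {s u : Multiset ℕ} (hs : Pos s) (hu : Pos u)
    (h : ∀ i, 1 ≤ i → cc s i = cc u i) : s = u := by
  ext i
  rcases Nat.eq_zero_or_pos i with rfl | hi
  · rw [Multiset.count_eq_zero_of_notMem, Multiset.count_eq_zero_of_notMem]
    · intro h; exact absurd (hu 0 h) (by omega)
    · intro h; exact absurd (hs 0 h) (by omega)
  · have h1 := count_eq s i
    have h2 := count_eq u i
    have h3 := h i hi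
    have h4 := h (i+1) (by omega)
    omega

lemma cj_pos (s : Multiset ℕ) : Pos (cj s) := by
  intro x hx
  unfold cj at hx
  rw [Multiset.mem_filter] at hx
  omega

lemma cj_sum (s : Multiset ℕ) : (cj s).sum = s.sum := by
  have h : ∀ u : Multiset ℕ, (u.filter (fun x => x ≠ 0)).sum = u.sum := by
    intro u
    induction u using Multiset.induction_on with
    | empty => simp
    | cons a u ih =>
      by_cases h : a = 0
      · subst h; simpa using ih
      · rw [Multiset.filter_cons_of_pos (p := fun x => x ≠ 0) _ h, Multiset.sum_cons, Multiset.sum_cons, ih]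
  unfold cj
  rw [h]
  exact sum_cc s s.sum (fun x hx => Multiset.le_sum_of_mem hx)

lemma card_filter_cj (s : Multiset ℕ) (q : ℕ → Prop) (hq : ¬ q 0) :
    Multiset.card ((cj s).filter q) = ((Finset.Icc 1 s.sum).filter (fun i => q (cc s i))).card := by
  unfold cj
  rw [Multiset.filter_filter, Multiset.filter_map, Multiset.card_map, Finset.card_def,
    Finset.filter_val]
  congr 1
  apply Multiset.filter_congr
  intro x _
  constructor
  · exact fun h => h.1
  · intro h
    refine ⟨h, ?_⟩
    intro h0
    have h0 : cc s x = 0 := h0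
    rw [h0] at h
    exact hq h

lemma pt_le_sum (s : Multiset ℕ) {j : ℕ} (hj : 1 ≤ j) : pt s j ≤ s.sum := by
  by_contra h
  have := (galois s (i := s.sum + 1) (by omega) hj).1 (by omega)
  rw [cc_eq_zero s (by omega)] at this
  omega

lemma cc_cj (s : Multiset ℕ) {j : ℕ} (hj : 1 ≤ j) : cc (cj s) j = pt s j := by
  have h : cc (cj s) j = Multiset.card ((cj s).filter (fun x => j ≤ x)) := rfl
  have h2 := card_filter_cj s (fun x => j ≤ x) (by omega)
  have h3 : (Finset.Icc 1 s.sum).filter (fun i => j ≤ cc s i) = Finset.Icc 1 (pt s j) := by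
    ext i
    have := pt_le_sum s hj
    simp only [Finset.mem_filter, Finset.mem_Icc]
    constructor
    · rintro ⟨⟨a, b⟩, c⟩
      exact ⟨a, (galois s a hj).2 c⟩
    · rintro ⟨a, b⟩
      exact ⟨⟨a, by omega⟩, (galois s a hj).1 b⟩
  rw [h]
  convert h2 using 1
  · congr!
  · have : (pt s j) = (Finset.Icc 1 (pt s j)).card := by simp
    rw [this, ← h3]
    congr!

lemma pt_cj (s : Multiset ℕ) {j : ℕ} (hj : 1 ≤ j) : pt (cj s) j = cc s j := by
  have h : ∀ i, 1 ≤ i → (i ≤ pt (cj s) j ↔ i ≤ cc s j) := by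
    intro i hi
    rw [galois _ hi hj, cc_cj s hi, galois s hj hi]
  have h1 := h (pt (cj s) j)
  have h2 := h (cc s j)
  by_contra hne
  rcases Nat.lt_or_gt_of_ne hne with h' | h'
  · have := (h2 (by omega)).2 le_rfl; omega
  · have := (h1 (by omega)).1 le_rfl; omega

lemma cj_cj {s : Multiset ℕ} (hs : Pos s) : cj (cj s) = s := by
  apply ext_cc (cj_pos _) hs
  intro i hi
  rw [cc_cj _ hi, pt_cj _ hi]

lemma count_cj (s : Multiset ℕ) {i : ℕ} (hi : 1 ≤ i) :
    (cj s).count i = pt s i - pt s (i + 1) := by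
  have := count_eq (cj s) i
  rw [cc_cj s hi, cc_cj s (by omega)] at this
  omega

lemma cj_mem {n : ℕ} {s : Multiset ℕ} (h : s ∈ MM n) : cj s ∈ MM n := by
  rw [mem_MM] at *
  exact ⟨cj_pos s, by rw [cj_sum]; exact h.2⟩

lemma pt_card (s : Multiset ℕ) {i : ℕ} (hi : Multiset.card s < i) : pt s i = 0 := by
  unfold pt
  apply List.getD_eq_default
  rw [Multiset.length_sort]; omega

def flat (r : ℕ) (s : Multiset ℕ) : Prop :=
  ∀ i, 1 ≤ i → i ≤ Multiset.card s → pt s i - pt s (i + 1) ≤ r - 1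
def restr (r : ℕ) (s : Multiset ℕ) : Prop := ∀ x, s.count x ≤ r - 1
def reg (r : ℕ) (s : Multiset ℕ) : Prop := ∀ x ∈ s, ¬ r ∣ x
def lm (r t : ℕ) (s : Multiset ℕ) : ℕ := Multiset.card (s.filter (fun x => x % r = t % r))
def lr (t : ℕ) (s : Multiset ℕ) : ℕ := (s.toFinset.filter (fun x => t ≤ s.count x)).card
def dc (t : ℕ) (s : Multiset ℕ) : ℕ :=
  ((Finset.Icc 1 (Multiset.card s)).filter (fun i => t ≤ pt s i - pt s (i + 1))).card
def gg (r t : ℕ) (s : Multiset ℕ) : ℕ :=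
  ((Finset.Icc 1 s.sum).filter (fun i => cc s i % r = t % r)).card

lemma flat_iff (r : ℕ) (s : Multiset ℕ) : flat r s ↔ restr r (cj s) := by
  constructor
  · intro h x
    rcases Nat.eq_zero_or_pos x with rfl | hx
    · rw [Multiset.count_eq_zero_of_notMem]
      · omega
      · intro h; exact absurd (cj_pos s 0 h) (by omega)
    · rw [count_cj s hx]
      by_cases hc : x ≤ Multiset.card s
      · exact h x hx hc
      · rw [pt_card s (by omega)]; omega
  · intro h i hi _
    rw [← count_cj s hi]
    exact h i

lemma dc_eq (t : ℕ) (ht : 1 ≤ t) (s : Multiset ℕ) : dc t s = lr t (cj s) := by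
  unfold dc lr
  congr 1
  ext i
  simp only [Finset.mem_filter, Finset.mem_Icc, Multiset.mem_toFinset]
  constructor
  · rintro ⟨⟨a, b⟩, c⟩
    rw [← count_cj s a] at c
    exact ⟨Multiset.count_pos.1 (by omega), c⟩
  · rintro ⟨a, c⟩
    have hi : 1 ≤ i := cj_pos s i a
    rw [count_cj s hi] at c
    refine ⟨⟨hi, ?_⟩, c⟩
    by_contra hc
    rw [pt_card s (by omega)] at c
    omega

lemma lm_cj (r t : ℕ) (ht : t % r ≠ 0) (s : Multiset ℕ) : lm r t (cj s) = gg r t s := by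
  have := card_filter_cj s (fun x => x % r = t % r) (by simp; omega)
  unfold lm gg
  convert this using 1
  · congr!
  · congr!

lemma gg_eq (r t : ℕ) (ht : t % r ≠ 0) (s : Multiset ℕ) (N : ℕ) (h : s.sum ≤ N) :
    gg r t s = ((Finset.Icc 1 N).filter (fun i => cc s i % r = t % r)).card := by
  unfold gg
  congr 1
  ext i
  simp only [Finset.mem_filter, Finset.mem_Icc]
  constructor
  · rintro ⟨⟨a, b⟩, c⟩
    exact ⟨⟨a, by omega⟩, c⟩
  · rintro ⟨⟨a, b⟩, c⟩
    refine ⟨⟨a, ?_⟩, c⟩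
    by_contra hc
    rw [cc_eq_zero s (by omega)] at c
    simp at c; omega

lemma sum_lm_eq_gg (n r t : ℕ) (ht : t % r ≠ 0) :
    ∑ s ∈ MM n, (lm r t s : ℤ) = ∑ s ∈ MM n, (gg r t s : ℤ) := by
  refine Finset.sum_bij' (fun s _ => cj s) (fun s _ => cj s) (fun s h => cj_mem h)
    (fun s h => cj_mem h) (fun s h => cj_cj (mem_MM.1 h).1) (fun s h => cj_cj (mem_MM.1 h).1) ?_
  intro s h
  rw [← lm_cj r t ht, cj_cj (mem_MM.1 h).1]

lemma sum_flat (n r t : ℕ) (ht : t % r ≠ 0) (ht1 : 1 ≤ t) :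
    ∑ s ∈ (MM n).filter (flat r), ((lm r t s : ℤ) - (dc t s : ℤ)) =
    ∑ s ∈ (MM n).filter (restr r), ((gg r t s : ℤ) - (lr t s : ℤ)) := by
  refine Finset.sum_bij' (fun s _ => cj s) (fun s _ => cj s) ?_ ?_ ?_ ?_ ?_
  · intro s h
    rw [Finset.mem_filter] at *
    exact ⟨cj_mem h.1, (flat_iff r s).1 h.2⟩
  · intro s h
    rw [Finset.mem_filter] at *
    refine ⟨cj_mem h.1, (flat_iff r _).2 ?_⟩
    rw [cj_cj (mem_MM.1 h.1).1]; exact h.2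
  · intro s h
    exact cj_cj (mem_MM.1 (Finset.mem_filter.1 h).1).1
  · intro s h
    exact cj_cj (mem_MM.1 (Finset.mem_filter.1 h).1).1
  · intro s h
    rw [← lm_cj r t ht, cj_cj (mem_MM.1 (Finset.mem_filter.1 h).1).1, dc_eq t ht1]

noncomputable def BB (r n : ℕ) : Finset (Multiset ℕ) :=
  ((Finset.range (n + 1)).biUnion MM).filter (fun b => r * b.sum ≤ n)

lemma mem_BB {r n : ℕ} (hr : 1 ≤ r) {b : Multiset ℕ} : b ∈ BB r n ↔ Pos b ∧ r * b.sum ≤ n := by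
  unfold BB
  simp only [Finset.mem_filter, Finset.mem_biUnion, Finset.mem_range, mem_MM]
  constructor
  · rintro ⟨⟨k, _, h, _⟩, h2⟩; exact ⟨h, h2⟩
  · rintro ⟨h, h2⟩
    refine ⟨⟨b.sum, ?_, h, rfl⟩, h2⟩
    nlinarith

lemma decomp (r : ℕ) (hr : 1 ≤ r) (f : Multiset ℕ → ℤ) (Q : Multiset ℕ → Prop)
    (ψ φ J : Multiset ℕ → Multiset ℕ)
    (h1 : ∀ s, Pos s → ψ s + J (φ s) = s) (h2 : ∀ s, Pos s → Q (ψ s))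
    (h3 : ∀ s, Pos s → Pos (φ s)) (h4 : ∀ b, (J b).sum = r * b.sum)
    (h5 : ∀ b, Pos b → Pos (J b))
    (h6 : ∀ a b, Pos a → Pos b → Q a → ψ (a + J b) = a)
    (h7 : ∀ a b, Pos a → Pos b → Q a → φ (a + J b) = b)
    (h8 : ∀ a b, Pos a → Pos b → f (a + J b) = f a) (n : ℕ) :
    ∑ s ∈ MM n, f s = ∑ b ∈ BB r n, ∑ a ∈ (MM (n - r * b.sum)).filter Q, f a := by
  have key : ∀ s, Pos s → (ψ s).sum + r * (φ s).sum = s.sum := by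
    intro s hs
    rw [← h4, ← Multiset.sum_add, h1 s hs]
  rw [← Finset.sum_fiberwise_of_maps_to (s := MM n) (t := BB r n) (g := φ)]
  · apply Finset.sum_congr rfl
    intro b hb
    rw [mem_BB hr] at hb
    refine Finset.sum_bij' (fun s _ => ψ s) (fun a _ => a + J b) ?_ ?_ ?_ ?_ ?_
    · intro s h
      rw [Finset.mem_filter, mem_MM] at h
      obtain ⟨⟨hp, hs⟩, rfl⟩ := h
      rw [Finset.mem_filter, mem_MM]
      have := key s hp
      refine ⟨⟨?_, by omega⟩, h2 s hp⟩
      intro x hx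
      apply hp
      rw [← h1 s hp]
      exact Multiset.mem_add.2 (Or.inl hx)
    · intro a h
      rw [Finset.mem_filter, mem_MM] at h
      obtain ⟨⟨hp, hs⟩, hq⟩ := h
      rw [Finset.mem_filter, mem_MM]
      refine ⟨⟨?_, ?_⟩, h7 a b hp hb.1 hq⟩
      · intro x hx
        rcases Multiset.mem_add.1 hx with hx | hx
        · exact hp x hx
        · exact h5 b hb.1 x hx
      · rw [Multiset.sum_add, h4]; omega
    · intro s h
      rw [Finset.mem_filter, mem_MM] at h
      obtain ⟨⟨hp, hs⟩, rfl⟩ := h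
      exact h1 s hp
    · intro a h
      rw [Finset.mem_filter, mem_MM] at h
      exact h6 a b h.1.1 hb.1 h.2
    · intro s h
      rw [Finset.mem_filter, mem_MM] at h
      obtain ⟨⟨hp, hs⟩, rfl⟩ := h
      have hpp : Pos (ψ s) := by
        intro x hx
        apply hp
        rw [← h1 s hp]
        exact Multiset.mem_add.2 (Or.inl hx)
      have := h8 (ψ s) (φ s) hpp hb.1
      rwa [h1 s hp] at this
  · intro s hs
    rw [mem_MM] at hs
    rw [mem_BB hr]
    have := key s hs.1
    exact ⟨h3 s hs.1, by omega⟩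

lemma decomp_reg (r t n : ℕ) (hr : 1 ≤ r) (ht : t % r ≠ 0) :
    ∑ s ∈ MM n, (lm r t s : ℤ) =
      ∑ b ∈ BB r n, ∑ a ∈ (MM (n - r * b.sum)).filter (reg r), (lm r t a : ℤ) := by
  have hdiv : ∀ b : Multiset ℕ, (b.map (fun x => r * x)).filter (fun x => ¬ r ∣ x) = 0 := by
    intro b
    rw [Multiset.filter_eq_nil]
    intro x hx
    obtain ⟨y, _, rfl⟩ := Multiset.mem_map.1 hx
    simp
  have hdiv' : ∀ b : Multiset ℕ, (b.map (fun x => r * x)).filter (fun x => r ∣ x)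
      = b.map (fun x => r * x) := by
    intro b
    rw [Multiset.filter_eq_self]
    intro x hx
    obtain ⟨y, _, rfl⟩ := Multiset.mem_map.1 hx
    simp
  apply decomp r hr _ _ (fun s => s.filter (fun x => ¬ r ∣ x))
    (fun s => (s.filter (fun x => r ∣ x)).map (fun x => x / r))
    (fun b => b.map (fun x => r * x))
  · intro s _
    simp only [Multiset.map_map]
    rw [Multiset.map_congr (g := id) rfl, Multiset.map_id, add_comm, Multiset.filter_add_not]
    intro x hx
    exact Nat.mul_div_cancel' (Multiset.mem_filter.1 hx).2
  · intro s _ x hx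
    exact (Multiset.mem_filter.1 hx).2
  · intro s hs x hx
    obtain ⟨y, hy, rfl⟩ := Multiset.mem_map.1 hx
    rw [Multiset.mem_filter] at hy
    exact Nat.div_pos (Nat.le_of_dvd (hs y hy.1) hy.2) hr
  · intro b
    rw [Multiset.sum_map_mul_left]; simp
  · intro b hb x hx
    obtain ⟨y, hy, rfl⟩ := Multiset.mem_map.1 hx
    exact Nat.mul_pos hr (hb y hy)
  · intro a b _ _ hq
    simp only [Multiset.filter_add, hdiv, add_zero]
    exact Multiset.filter_eq_self.2 hq
  · intro a b _ _ hq
    simp only [Multiset.filter_add, hdiv']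
    rw [Multiset.filter_eq_nil.2 hq, zero_add, Multiset.map_map]
    conv_rhs => rw [← Multiset.map_id b]
    apply Multiset.map_congr rfl
    intro x _
    simp only [Function.comp, id]
    exact Nat.mul_div_cancel_left x hr
  · intro a b _ _
    unfold lm
    rw [Multiset.filter_add, Multiset.card_add]
    have : Multiset.filter (fun x => x % r = t % r) (b.map (fun x => r * x)) = 0 := by
      rw [Multiset.filter_eq_nil]
      intro x hx
      obtain ⟨y, _, rfl⟩ := Multiset.mem_map.1 hx
      simp; omega
    rw [this]; simp

/-- apply a function to all multiplicities -/
def mc (h : ℕ → ℕ) (s : Multiset ℕ) : Multiset ℕ :=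
  ∑ x ∈ s.toFinset, Multiset.replicate (h (s.count x)) x

lemma count_mc (h : ℕ → ℕ) (h0 : h 0 = 0) (s : Multiset ℕ) (x : ℕ) :
    (mc h s).count x = h (s.count x) := by
  unfold mc
  rw [Multiset.count_sum']
  simp only [Multiset.count_replicate]
  rw [Finset.sum_ite_eq' s.toFinset x]
  split_ifs with hx
  · rfl
  · rw [Multiset.mem_toFinset] at hx
    rw [Multiset.count_eq_zero_of_notMem hx, h0]

lemma mc_pos (h : ℕ → ℕ) (s : Multiset ℕ) (hs : Pos s) : Pos (mc h s) := by
  intro x hx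
  unfold mc at hx
  rw [Multiset.mem_sum] at hx
  obtain ⟨y, hy, hxy⟩ := hx
  rw [Multiset.eq_of_mem_replicate hxy]
  exact hs y (Multiset.mem_toFinset.1 hy)

lemma decomp_restr (r t n : ℕ) (hr : 1 ≤ r) (ht : t % r ≠ 0) :
    ∑ s ∈ MM n, (gg r t s : ℤ) =
      ∑ b ∈ BB r n, ∑ a ∈ (MM (n - r * b.sum)).filter (restr r), (gg r t a : ℤ) := by
  apply decomp r hr _ _ (mc (fun k => k % r)) (mc (fun k => k / r)) (fun b => r • b)
  · intro s _
    ext x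
    rw [Multiset.count_add, Multiset.count_nsmul, count_mc _ (by simp), count_mc _ (by simp)]
    exact Nat.mod_add_div _ _
  · intro s _ x
    rw [count_mc _ (by simp)]
    have := Nat.mod_lt (s.count x) hr
    omega
  · intro s hs
    exact mc_pos _ s hs
  · intro b
    rw [Multiset.sum_nsmul]; simp
  · intro b hb x hx
    exact hb x (Multiset.mem_of_mem_nsmul hx)
  · intro a b _ _ hq
    ext x
    rw [count_mc _ (by simp), Multiset.count_add, Multiset.count_nsmul]
    have := hq x
    rw [Nat.add_mul_mod_self_left, Nat.mod_eq_of_lt (by omega)]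
  · intro a b _ _ hq
    ext x
    rw [count_mc _ (by simp), Multiset.count_add, Multiset.count_nsmul]
    have := hq x
    rw [Nat.add_mul_div_left _ _ hr, Nat.div_eq_of_lt (by omega), zero_add]
  · intro a b _ _
    rw [gg_eq r t ht a (a + r • b).sum (by rw [Multiset.sum_add]; omega)]
    unfold gg
    simp only [cc_add, cc_nsmul, Nat.add_mul_mod_self_left]

lemma sum_reg_eq (r t : ℕ) (hr : 1 ≤ r) (ht : t % r ≠ 0) (n : ℕ) :
    ∑ a ∈ (MM n).filter (reg r), (lm r t a : ℤ) =
      ∑ a ∈ (MM n).filter (restr r), (gg r t a : ℤ) := by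
  induction n using Nat.strong_induction_on with
  | _ n ih =>
    have h := sum_lm_eq_gg n r t ht
    rw [decomp_reg r t n hr ht, decomp_restr r t n hr ht] at h
    have h0 : (0 : Multiset ℕ) ∈ BB r n := by
      rw [mem_BB hr]; simp [Pos]
    rw [← Finset.add_sum_erase _ _ h0, ← Finset.add_sum_erase _ _ h0] at h
    have h2 : ∑ b ∈ (BB r n).erase 0, ∑ a ∈ (MM (n - r * b.sum)).filter (reg r), (lm r t a : ℤ)
        = ∑ b ∈ (BB r n).erase 0, ∑ a ∈ (MM (n - r * b.sum)).filter (restr r), (gg r t a : ℤ) := by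
      apply Finset.sum_congr rfl
      intro b hb
      rw [Finset.mem_erase, mem_BB hr] at hb
      apply ih
      obtain ⟨hb0, hp, hle⟩ := hb
      obtain ⟨x, hx⟩ := Multiset.exists_mem_of_ne_zero hb0
      have h3 := hp x hx
      have h4 := Multiset.le_sum_of_mem hx
      have : 0 < r * b.sum := Nat.mul_pos hr (by omega)
      omega
    rw [h2] at h
    simpa using h

theorem excess_eq_flat_sum (n r t : ℕ) (hr : 2 ≤ r) (ht1 : 1 ≤ t) (ht2 : t ≤ r - 1) :
    ((∑ p ∈ Finset.univ.filter (fun p : n.Partition => IsRegular r p), (lMod r t p : ℤ)) -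
      ∑ p ∈ Finset.univ.filter (fun p : n.Partition => IsRestricted r p), (lRep t p : ℤ)) =
      ∑ p ∈ Finset.univ.filter (fun p : n.Partition => IsFlat r p), ((lMod r t p : ℤ) - (dCount t p : ℤ)) := by
  have ht : t % r ≠ 0 := by
    rw [Nat.mod_eq_of_lt (by omega)]; omega
  have e1 := sum_MM (n := n) (fun s => (lm r t s : ℤ)) (reg r)
  have e2 := sum_MM (n := n) (fun s => (lr t s : ℤ)) (restr r)
  have e3 := sum_MM (n := n) (fun s => (lm r t s : ℤ) - (dc t s : ℤ)) (flat r)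
  have e4 := sum_flat n r t ht ht1
  have e5 := sum_reg_eq r t (by omega) ht n
  rw [Finset.sum_sub_distrib] at e4
  rw [Finset.sum_sub_distrib (f := fun s => (gg r t s : ℤ)), ← e5, ← e1, ← e2, ← Finset.sum_sub_distrib, ← e3] at e4
  exact e4.symm

end BeckPaper
end

section
/- Let n ≥ 0, r ≥ 2 and 1 ≤ t ≤ r−1 be integers. Then the total number of parts congruent to t mod r in all r-regular partitions of n equals the number of triples (μ, a, i) with a ≥ 0 an integer, i ≥ 1 an integer, and μ an r-flat partition of n − i(ar + t): Σ_{λ∈O_r(n)} ℓ_t(λ) = #{(μ, a, i) : a ≥ 0, i ≥ 1, μ ∈ F_r(n − i(ar+t))}. -/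
open scoped Classical

namespace BeckPaper

lemma card_add_rep (r m i x : ℕ) (hx : 1 ≤ x) (hrx : ¬ r ∣ x) :
    (Finset.univ.filter (fun p : m.Partition => IsRegular r p)).card =
    (Finset.univ.filter (fun p : (m + i * x).Partition =>
      IsRegular r p ∧ i ≤ p.parts.count x)).card := by
  refine Finset.card_bij (fun p _ => ⟨p.parts + Multiset.replicate i x, ?_, ?_⟩) ?_ ?_ ?_
  · intro j hj
    rcases Multiset.mem_add.1 hj with h | h
    · exact p.parts_pos h
    · rw [Multiset.eq_of_mem_replicate h]; exact hx
  · simp [p.parts_sum]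
  · intro p hp
    simp only [Finset.mem_filter, Finset.mem_univ, true_and] at hp ⊢
    refine ⟨?_, ?_⟩
    · intro j hj
      rcases Multiset.mem_add.1 hj with h | h
      · exact hp j h
      · rw [Multiset.eq_of_mem_replicate h]; exact hrx
    · simp [Multiset.count_add]
  · intro p _ q _ h
    have := congrArg Nat.Partition.parts h
    simp only [add_left_inj] at this
    exact Nat.Partition.ext this
  · intro q hq
    simp only [Finset.mem_filter, Finset.mem_univ, true_and] at hq
    have hle : Multiset.replicate i x ≤ q.parts := Multiset.le_count_iff_replicate_le.1 hq.2
    have he : q.parts - Multiset.replicate i x + Multiset.replicate i x = q.parts :=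
      Multiset.sub_add_cancel hle
    refine ⟨⟨q.parts - Multiset.replicate i x, ?_, ?_⟩, ?_, ?_⟩
    · intro j hj
      exact q.parts_pos (Multiset.mem_of_le (Multiset.sub_le_self _ _) hj)
    · have := congrArg Multiset.sum he
      rw [Multiset.sum_add, q.parts_sum] at this
      simpa using this
    · simp only [Finset.mem_filter, Finset.mem_univ, true_and]
      intro j hj
      exact hq.1 j (Multiset.mem_of_le (Multiset.sub_le_self _ _) hj)
    · exact Nat.Partition.ext he

lemma length_partsList {n : ℕ} (p : n.Partition) : (partsList p).length = numParts p := by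
  simp [partsList, numParts]

lemma part_zero {n : ℕ} (p : n.Partition) (i : ℕ) (h : numParts p ≤ i) : part p (i + 1) = 0 := by
  unfold part
  rw [← length_partsList] at h
  simp [h]

lemma part_get {n : ℕ} (p : n.Partition) (i : ℕ) (h : i < (partsList p).length) :
    part p (i + 1) = (partsList p)[i] := by
  unfold part
  simp [h]

lemma part_pos {n : ℕ} (p : n.Partition) (i : ℕ) (h : i < numParts p) : 0 < part p (i + 1) := by
  rw [← length_partsList] at h
  rw [part_get p i h]
  apply p.parts_pos
  exact (Multiset.mem_sort (r := (· ≥ ·))).1 (List.getElem_mem h)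

lemma part_anti {n : ℕ} (p : n.Partition) (i : ℕ) : part p (i + 2) ≤ part p (i + 1) := by
  by_cases h : i + 1 < (partsList p).length
  · rw [part_get p i (by omega), part_get p (i+1) h]
    have : (partsList p).Pairwise (· ≥ ·) := Multiset.pairwise_sort _ _
    exact List.pairwise_iff_getElem.1 this i (i+1) _ _ (by omega)
  · rw [length_partsList] at h
    rw [part_zero p (i+1) (by omega)]; exact Nat.zero_le _

lemma numParts_le {n : ℕ} (p : n.Partition) : numParts p ≤ n := by
  have h : Multiset.card p.parts • 1 ≤ p.parts.sum :=
    Multiset.card_nsmul_le_sum (fun x hx => p.parts_pos hx)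
  rw [p.parts_sum] at h
  simpa [numParts] using h

lemma list_sum_getD (l : List ℕ) : ∀ N, l.length ≤ N →
    ∑ i ∈ Finset.range N, l.getD i 0 = l.sum := by
  induction l with
  | nil => intro N _; simp
  | cons a l ih =>
    intro N hN
    obtain ⟨M, rfl⟩ : ∃ M, N = M + 1 := ⟨N - 1, by simp at hN; omega⟩
    rw [Finset.sum_range_succ']
    have := ih M (by simpa using hN)
    simp only [List.getD_cons_succ, List.getD_cons_zero, List.sum_cons, this]
    omega

lemma sum_part {n : ℕ} (p : n.Partition) : ∑ i ∈ Finset.range n, part p (i + 1) = n := by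
  have := list_sum_getD (partsList p) n (by rw [length_partsList]; exact numParts_le p)
  have h2 : (partsList p).sum = n := by
    rw [← Multiset.sum_coe]; simp [partsList, p.parts_sum]
  rw [h2] at this
  simpa [part] using this

lemma abel (f : ℕ → ℕ) (hf : ∀ i, f (i + 1) ≤ f i) (N : ℕ) :
    ∑ i ∈ Finset.range N, (f i - f (i + 1)) * (i + 1) + N * f N = ∑ i ∈ Finset.range N, f i := by
  induction N with
  | zero => simp
  | succ k ih =>
    rw [Finset.sum_range_succ, Finset.sum_range_succ, ← ih]
    obtain ⟨d, hd⟩ := Nat.exists_eq_add_of_le (hf k)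
    rw [hd]
    simp only [Nat.add_sub_cancel_left]
    ring

/-- conjugate -/
noncomputable def conj {n : ℕ} (p : n.Partition) : n.Partition where
  parts := ∑ i ∈ Finset.range n, Multiset.replicate (part p (i + 1) - part p (i + 2)) (i + 1)
  parts_pos := by
    intro j hj
    obtain ⟨i, _, h⟩ := Multiset.mem_sum.1 hj
    rw [Multiset.eq_of_mem_replicate h]; omega
  parts_sum := by
    have h := abel (fun i => part p (i + 1)) (part_anti p) n
    simp only [sum_part, part_zero p n (numParts_le p), mul_zero, add_zero] at h
    have e : (∑ i ∈ Finset.range n, Multiset.replicate (part p (i + 1) - part p (i + 2)) (i + 1)).sum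
      = ∑ i ∈ Finset.range n, (part p (i + 1) - part p (i + 2)) * (i + 1) := by
      rw [← Multiset.coe_sumAddMonoidHom, map_sum]
      simp
    rw [e]; exact h

lemma count_conj {n : ℕ} (p : n.Partition) (i : ℕ) :
    (conj p).parts.count (i + 1) = part p (i + 1) - part p (i + 2) := by
  simp only [conj, Multiset.count_sum', Multiset.count_replicate]
  by_cases h : i < n
  · simp [h]
  · rw [part_zero p i (by have := numParts_le p; omega)]
    simp only [Nat.zero_sub, Nat.add_right_cancel_iff, Finset.sum_ite_eq']
    simp [h]

lemma conj_inj {n : ℕ} : Function.Injective (conj (n := n)) := by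
  intro p q h
  have hd : ∀ i, part p (i + 1) - part p (i + 2) = part q (i + 1) - part q (i + 2) := by
    intro i; rw [← count_conj, ← count_conj, h]
  have hp : ∀ d i, n ≤ i + d → part p (i + 1) = part q (i + 1) := by
    intro d
    induction d with
    | zero =>
      intro i hi
      rw [part_zero p i (by have := numParts_le p; omega),
        part_zero q i (by have := numParts_le q; omega)]
    | succ d ih =>
      intro i hi
      have h1 := ih (i + 1) (by omega)
      have h2 := hd i
      have h3 := part_anti p i
      have h4 := part_anti q i
      have h5 : part p (i + 2) = part q (i + 2) := h1
      omega
  have hp' : ∀ i, part p (i + 1) = part q (i + 1) := fun i => hp n i (by omega)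
  have hl : numParts p = numParts q := by
    rcases lt_trichotomy (numParts p) (numParts q) with hh | hh | hh
    · have h1 := part_pos q _ hh
      rw [← hp', part_zero p _ le_rfl] at h1; omega
    · exact hh
    · have h1 := part_pos p _ hh
      rw [hp', part_zero q _ le_rfl] at h1; omega
  have hL : partsList p = partsList q := by
    apply List.ext_getElem
    · rw [length_partsList, length_partsList, hl]
    · intro i h1 h2
      rw [← part_get, ← part_get, hp']
  apply Nat.Partition.ext
  have := congrArg (fun l : List ℕ => (l : Multiset ℕ)) hL
  simpa [partsList] using this

lemma flat_iff_s13 {n r : ℕ} (hr : 2 ≤ r) (p : n.Partition) :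
    IsFlat r p ↔ conj p ∈ Nat.Partition.countRestricted n r := by
  simp only [Nat.Partition.countRestricted, Finset.mem_filter, Finset.mem_univ, true_and]
  constructor
  · intro h j hj
    obtain ⟨i, rfl⟩ : ∃ i, j = i + 1 := ⟨j - 1, by have := (conj p).parts_pos hj; omega⟩
    rw [count_conj]
    by_cases hi : i < numParts p
    · have := h (i + 1) (by omega) (by omega)
      have h5 : part p (i + 1) - part p (i + 2) ≤ r - 1 := this
      omega
    · rw [part_zero p i (by omega)]; omega
  · intro h j hj _
    obtain ⟨i, rfl⟩ : ∃ i, j = i + 1 := ⟨j - 1, by omega⟩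
    have := count_conj p i
    change part p (i + 1) - part p (i + 2) ≤ r - 1
    rw [← this]
    by_cases hm : i + 1 ∈ (conj p).parts
    · have := h _ hm; omega
    · rw [Multiset.count_eq_zero_of_notMem hm]; omega

lemma card_flat (n r : ℕ) (hr : 2 ≤ r) :
    (Finset.univ.filter (fun p : n.Partition => IsFlat r p)).card =
    (Finset.univ.filter (fun p : n.Partition => IsRegular r p)).card := by
  have hb : Function.Bijective (conj (n := n)) := Finite.injective_iff_bijective.1 conj_inj
  have h1 := Nat.Partition.card_restricted_eq_card_countRestricted n (m := r) (by omega)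
  have h2 : (Finset.univ.filter (fun p : n.Partition => IsFlat r p)).card =
      (Nat.Partition.countRestricted n r).card := by
    refine Finset.card_bij (fun p _ => conj p) ?_ ?_ ?_
    · intro p hp; exact (flat_iff_s13 hr p).1 (by simpa using hp)
    · intro p _ q _ h; exact conj_inj h
    · intro q hq
      obtain ⟨p, rfl⟩ := hb.2 q
      exact ⟨p, by simpa using (flat_iff_s13 hr p).2 hq, rfl⟩
  rw [h2, ← h1]
  congr 1
  ext p
  unfold Nat.Partition.restricted
  rw [Finset.mem_filter, Finset.mem_filter]
  rfl

lemma lMod_eq (n r t : ℕ) (hr : 2 ≤ r) (ht1 : 1 ≤ t) (ht2 : t ≤ r - 1) (p : n.Partition) :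
    lMod r t p = ∑ a ∈ Finset.range (n + 1), ∑ i ∈ Finset.Icc 1 n,
      if i ≤ p.parts.count (a * r + t) then 1 else 0 := by
  have hc : ∀ x, p.parts.count x ≤ n := fun x =>
    (Multiset.count_le_card _ _).trans (numParts_le p)
  have h1 : ∀ a, (∑ i ∈ Finset.Icc 1 n, if i ≤ p.parts.count (a * r + t) then 1 else 0)
      = p.parts.count (a * r + t) := by
    intro a
    rw [← Finset.card_filter]
    have : (Finset.Icc 1 n).filter (fun i => i ≤ p.parts.count (a * r + t))
      = Finset.Icc 1 (p.parts.count (a * r + t)) := by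
      ext i
      have := hc (a * r + t)
      simp only [Finset.mem_filter, Finset.mem_Icc]; omega
    rw [this]; simp
  simp only [h1]
  have htr : t % r = t := Nat.mod_eq_of_lt (by omega)
  have hmod : ∀ a, (a * r + t) % r = t := by
    intro a; rw [Nat.mul_add_mod_self_right, htr]
  have hinj : Set.InjOn (fun a => a * r + t) (Finset.range (n + 1) : Set ℕ) := by
    intro a _ b _ h
    simp only [Nat.add_right_cancel_iff] at h
    exact Nat.eq_of_mul_eq_mul_right (by omega) h
  unfold lMod
  rw [← Multiset.sum_count_eq_card (s := (Finset.range (n + 1)).image (fun a => a * r + t))]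
  · rw [Finset.sum_image hinj]
    apply Finset.sum_congr rfl
    intro a _
    rw [Multiset.count_filter_of_pos]
    rw [hmod, htr]
  · intro x hx
    rw [Multiset.mem_filter] at hx
    have hxn := Nat.Partition.le_of_mem_parts hx.1
    rw [Finset.mem_image]
    refine ⟨x / r, ?_, ?_⟩
    · rw [Finset.mem_range]
      have := Nat.div_le_self x r
      omega
    · have := Nat.div_add_mod x r
      rw [hx.2, htr, mul_comm] at this
      exact this

lemma card_ge (n r x i : ℕ) (hr : 2 ≤ r) (hx : 1 ≤ x) (hrx : ¬ r ∣ x) :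
    (Finset.univ.filter (fun p : n.Partition => IsRegular r p ∧ i ≤ p.parts.count x)).card =
    ∑ m ∈ Finset.range (n + 1), if m + i * x = n then
      (Finset.univ.filter (fun p : m.Partition => IsFlat r p)).card else 0 := by
  by_cases h : i * x ≤ n
  · obtain ⟨m, rfl⟩ : ∃ m, n = m + i * x := ⟨n - i * x, by omega⟩
    simp only [Nat.add_right_cancel_iff, Finset.sum_ite_eq']
    rw [if_pos (by rw [Finset.mem_range]; omega), card_flat m r hr, card_add_rep r m i x hx hrx]
  · rw [Finset.sum_eq_zero, Finset.card_eq_zero, Finset.filter_eq_empty_iff]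
    · rintro p - ⟨_, hp⟩
      have hle : Multiset.replicate i x ≤ p.parts := Multiset.le_count_iff_replicate_le.1 hp
      obtain ⟨u, hu⟩ := Multiset.le_iff_exists_add.1 hle
      have := congrArg Multiset.sum hu
      rw [p.parts_sum, Multiset.sum_add, Multiset.sum_replicate, smul_eq_mul] at this
      omega
    · intro m _
      rw [if_neg (by omega)]

theorem parts_mod_eq_triples (n r t : ℕ) (hr : 2 ≤ r) (ht1 : 1 ≤ t) (ht2 : t ≤ r - 1) :
    (∑ p ∈ Finset.univ.filter (fun p : n.Partition => IsRegular r p), lMod r t p) =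
      Nat.card {x : Σ m : ℕ, m.Partition × ℕ × ℕ //
        IsFlat r x.2.1 ∧ 1 ≤ x.2.2.2 ∧ x.1 + x.2.2.2 * (x.2.2.1 * r + t) = n} := by
  rw [Nat.subtype_card (((Finset.range (n + 1)).sigma fun m =>
    (Finset.univ : Finset m.Partition) ×ˢ (Finset.range (n + 1) ×ˢ Finset.Icc 1 n)).filter
      (fun x => IsFlat r x.2.1 ∧ x.1 + x.2.2.2 * (x.2.2.1 * r + t) = n))]
  · rw [Finset.card_filter, Finset.sum_sigma]
    simp only [Finset.sum_product]
    simp only [lMod_eq n r t hr ht1 ht2]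
    rw [Finset.sum_comm]
    have hR : ∀ m ∈ Finset.range (n + 1), (∑ p : m.Partition, ∑ a ∈ Finset.range (n + 1),
        ∑ i ∈ Finset.Icc 1 n, if IsFlat r p ∧ m + i * (a * r + t) = n then 1 else 0) =
        ∑ a ∈ Finset.range (n + 1), ∑ i ∈ Finset.Icc 1 n, if m + i * (a * r + t) = n then
      (Finset.univ.filter (fun p : m.Partition => IsFlat r p)).card else 0 := by
      intro m _
      rw [Finset.sum_comm]
      refine Finset.sum_congr rfl fun a _ => ?_
      rw [Finset.sum_comm]
      refine Finset.sum_congr rfl fun i _ => ?_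
      by_cases h : m + i * (a * r + t) = n
      · simp [h]
      · simp [h]
    rw [Finset.sum_congr rfl hR]
    conv_rhs => rw [Finset.sum_comm]
    refine Finset.sum_congr rfl fun a _ => ?_
    rw [Finset.sum_comm]
    conv_rhs => rw [Finset.sum_comm]
    refine Finset.sum_congr rfl fun i _ => ?_
    rw [← card_ge n r (a * r + t) i hr (by omega) ?_, ← Finset.card_filter, Finset.filter_filter]
    intro hd
    have := (Nat.dvd_add_right (Dvd.intro_left a rfl)).1 hd
    have := Nat.le_of_dvd (by omega) this
    omega
  · rintro ⟨m, p, a, i⟩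
    simp only [Finset.mem_filter, Finset.mem_sigma, Finset.mem_product, Finset.mem_univ, true_and,
      Finset.mem_range, Finset.mem_Icc]
    constructor
    · rintro ⟨⟨_, _, h, _⟩, h1, h2⟩
      exact ⟨h1, h, h2⟩
    · rintro ⟨h1, h, h2⟩
      refine ⟨⟨by omega, ?_, h, ?_⟩, h1, h2⟩
      · have : a ≤ i * (a * r + t) := by nlinarith [Nat.zero_le a, Nat.mul_le_mul h (le_refl (a * r + t)), Nat.mul_le_mul (le_refl a) hr]
        omega
      · have : i ≤ i * (a * r + t) := Nat.le_mul_of_pos_right i (by omega)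
        omega

end BeckPaper
end
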